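/- Define S : ℝ × ℝ × ℝ × ℝ × ℝⁿ × ℝⁿ → ℂ by S(ϑ, t, θ, τ, η, r) = i·t·(1 − exp(i(ϑ − θ))) − ϑ + τ·θ + η·r, where η·r is the Euclidean dot product. Then on the domain {t > 0, ϑ − θ ∈ (−2π, 2π)}, the differential of S (equivalently, all first-order partial derivatives of S) vanishes at a point if and only if that point is (ϑ, t, θ, τ, η, r) = (0, 1, 0, 1, 0, 0). -/

import Mathlib

open Matrix

/-- The phase `S(ϑ, t, θ, τ, η, r) = i·t·(1 − e^{i(ϑ − θ)}) − ϑ + τ·θ + η·r`. -/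
noncomputable def phaseS (n : ℕ) :
    ℝ × ℝ × ℝ × ℝ × (Fin n → ℝ) × (Fin n → ℝ) → ℂ := fun p =>
  Complex.I * (p.2.1 : ℂ) * (1 - Complex.exp (Complex.I * ((p.1 : ℂ) - (p.2.2.1 : ℂ))))
    - (p.1 : ℂ) + (p.2.2.2.1 : ℂ) * (p.2.2.1 : ℂ)
    + ((p.2.2.2.2.1 ⬝ᵥ p.2.2.2.2.2 : ℝ) : ℂ)

theorem differentiable_phaseS (n : ℕ) : Differentiable ℝ (phaseS n) := by
  have hc : Differentiable ℝ (fun x : ℝ => (x : ℂ)) := Complex.ofRealCLM.differentiable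
  have h : Differentiable ℝ
      (fun p : ℝ × ℝ × ℝ × ℝ × (Fin n → ℝ) × (Fin n → ℝ) => p.2.2.2.2.1 ⬝ᵥ p.2.2.2.2.2) := by
    unfold dotProduct
    fun_prop
  have h₁ := hc.comp h
  unfold phaseS
  refine Differentiable.add ?_ h₁
  fun_prop

theorem fderiv_phaseS_apply {n : ℕ} (p v : ℝ × ℝ × ℝ × ℝ × (Fin n → ℝ) × (Fin n → ℝ)) :
    fderiv ℝ (phaseS n) p v =
      (p.2.1 * Complex.exp (Complex.I * ((p.1 : ℂ) - (p.2.2.1 : ℂ))) - 1) * v.1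
        + Complex.I * (1 - Complex.exp (Complex.I * ((p.1 : ℂ) - (p.2.2.1 : ℂ)))) * v.2.1
        + (p.2.2.2.1 - p.2.1 * Complex.exp (Complex.I * ((p.1 : ℂ) - (p.2.2.1 : ℂ)))) * v.2.2.1
        + p.2.2.1 * v.2.2.2.1
        + ((v.2.2.2.2.1 ⬝ᵥ p.2.2.2.2.2 + p.2.2.2.2.1 ⬝ᵥ v.2.2.2.2.2 : ℝ) : ℂ) := by
  obtain ⟨ϑ, t, θ, τ, η, r⟩ := p
  obtain ⟨a, b, c, d, e, f⟩ := v
  have affine (x y : ℝ) : HasDerivAt (fun s : ℝ => x + s * y) y 0 := by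
    simpa using ((hasDerivAt_id (0 : ℝ)).mul_const y).const_add x
  have affine_coe (x y : ℝ) : HasDerivAt (fun s : ℝ => ((x + s * y : ℝ) : ℂ)) (y : ℂ) 0 :=
    (affine x y).ofReal_comp
  have hdot : HasDerivAt (fun s : ℝ => (η + s • e) ⬝ᵥ (r + s • f)) (e ⬝ᵥ r + η ⬝ᵥ f) 0 := by
    have := HasDerivAt.fun_sum (u := Finset.univ)
      fun i _ => (affine (η i) (e i)).fun_mul (affine (r i) (f i))
    simpa [dotProduct, Finset.sum_add_distrib] using this
  have hexp := (((affine_coe ϑ a).fun_sub (affine_coe θ c)).const_mul Complex.I).cexp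
  have hline : HasLineDerivAt ℝ (phaseS n) _ (ϑ, t, θ, τ, η, r) (a, b, c, d, e, f) :=
    (((((affine_coe t b).const_mul Complex.I).fun_mul (hexp.const_sub 1)).fun_sub
      (affine_coe ϑ a)).fun_add ((affine_coe τ d).fun_mul (affine_coe θ c))).fun_add
      hdot.ofReal_comp
  rw [← (differentiable_phaseS n _).lineDeriv_eq_fderiv, hline.lineDeriv]
  simp only [zero_mul, add_zero]
  linear_combination (-(t : ℂ) * (a - c) *
    Complex.exp (Complex.I * ((ϑ : ℂ) - (θ : ℂ)))) * Complex.I_sq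

/-- On the domain `{t > 0, ϑ − θ ∈ (−2π, 2π)}`, the differential of `S` vanishes at a
point if and only if that point is `(ϑ, t, θ, τ, η, r) = (0, 1, 0, 1, 0, 0)`. -/
theorem phaseS_critical_point_iff {n : ℕ}
    (p : ℝ × ℝ × ℝ × ℝ × (Fin n → ℝ) × (Fin n → ℝ))
    (ht : 0 < p.2.1)
    (hrange : p.1 - p.2.2.1 ∈ Set.Ioo (-(2 * Real.pi)) (2 * Real.pi)) :
    fderiv ℝ (phaseS n) p = 0 ↔
      p = ((0 : ℝ), (1 : ℝ), (0 : ℝ), (1 : ℝ), (0 : Fin n → ℝ), (0 : Fin n → ℝ)) := by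
  constructor
  · intro h
    have key v := (fderiv_phaseS_apply p v).symm.trans (DFunLike.congr_fun h v)
    obtain ⟨ϑ, t, θ, τ, η, r⟩ := p
    have hϑ := key (1, 0, 0, 0, 0, 0)
    have hb := key (0, 1, 0, 0, 0, 0)
    have hθ := key (0, 0, 1, 0, 0, 0)
    have hτ := key (0, 0, 0, 1, 0, 0)
    have hη : r = 0 := dotProduct_eq_zero _ fun w => by
      have := key (0, 0, 0, 0, w, 0)
      rw [dotProduct_comm]
      simpa [← Complex.ofReal_add] using this
    have hr : η = 0 := dotProduct_eq_zero _ fun w => by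
      have := key (0, 0, 0, 0, 0, w)
      simpa [← Complex.ofReal_add] using this
    simp only [Complex.ofReal_zero, Complex.ofReal_one, mul_zero, mul_one, add_zero, zero_add,
      zero_dotProduct, dotProduct_zero, _root_.zero_apply, mul_eq_zero,
      Complex.I_ne_zero, false_or] at hϑ hb hθ hτ
    have hE := (sub_eq_zero.mp hb).symm
    rw [hE, mul_one, sub_eq_zero] at hϑ hθ
    have ht1 : t = 1 := by exact_mod_cast hϑ
    have hτ1 : τ = 1 := by exact_mod_cast hθ.trans hϑ
    have hθ0 : θ = 0 := by exact_mod_cast hτ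
    have hcos : Real.cos (ϑ - θ) = 1 := by
      have := congrArg Complex.re hE
      rwa [mul_comm, ← Complex.ofReal_sub, Complex.exp_ofReal_mul_I_re, Complex.one_re] at this
    have hsub := (Real.cos_eq_one_iff_of_lt_of_lt hrange.1 hrange.2).mp hcos
    have hϑ0 : ϑ = 0 := by linarith
    rw [hϑ0, ht1, hθ0, hτ1, hη, hr]
  · rintro rfl
    refine ContinuousLinearMap.ext fun v => ?_
    rw [fderiv_phaseS_apply]
    simp
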